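/- Let V be a finite type and r an acyclic relation on V (no a with TransGen r a a). Define r' by: r' a b if and only if r a b and there is no c with TransGen r a c and TransGen r c b. Then r' is contained in every relation with the same transitive closure: for any relation s on V with Relation.TransGen s = Relation.TransGen r, every pair (a,b) with r' a b also satisfies s a b. In particular r' is the unique minimal relation whose transitive closure equals that of r. -/

import Mathlib

/-- The reduction has the same transitive closure as `r` (the existence half of the
"in particular" clause; not part of the frozen statement). -/
theorem transGen_reduction_eq {V : Type*} [Finite V] (r : V → V → Prop)
    (hacyc : ¬ ∃ a : V, Relation.TransGen r a a) :
    Relation.TransGen (fun a b => r a b ∧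
      ¬ ∃ c : V, Relation.TransGen r a c ∧ Relation.TransGen r c b) = Relation.TransGen r := by
  have key : ∀ n : ℕ, ∀ a b : V,
      {c | Relation.TransGen r a c ∧ Relation.TransGen r c b}.ncard = n →
      Relation.TransGen r a b →
      Relation.TransGen (fun a b => r a b ∧
        ¬ ∃ c : V, Relation.TransGen r a c ∧ Relation.TransGen r c b) a b := by
    intro n
    induction n using Nat.strong_induction_on with
    | _ n ih =>
      intro a b hn hab
      by_cases h : ∃ c : V, Relation.TransGen r a c ∧ Relation.TransGen r c b
      · obtain ⟨c, hac, hcb⟩ := h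
        refine Relation.TransGen.trans (ih _ ?_ a c rfl hac) (ih _ ?_ c b rfl hcb)
        · rw [← hn]
          refine Set.ncard_lt_ncard ⟨fun d hd => ⟨hd.1, hd.2.trans hcb⟩, fun hsub => ?_⟩
            (Set.toFinite _)
          exact hacyc ⟨c, (hsub ⟨hac, hcb⟩).2⟩
        · rw [← hn]
          refine Set.ncard_lt_ncard ⟨fun d hd => ⟨hac.trans hd.1, hd.2⟩, fun hsub => ?_⟩
            (Set.toFinite _)
          exact hacyc ⟨c, (hsub ⟨hac, hcb⟩).1⟩
      · refine Relation.TransGen.single ⟨?_, h⟩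
        cases hab with
        | single h1 => exact h1
        | tail h1 h2 => exact absurd ⟨_, h1, Relation.TransGen.single h2⟩ h
  funext a b
  exact propext ⟨fun h => Relation.TransGen.mono (fun _ _ h => h.1) _ _ h, key _ a b rfl⟩

/-- The transitive reduction of an acyclic relation on a finite type is contained in
every relation having the same transitive closure; in particular it is the unique
minimal such relation. -/
theorem transitiveReduction_minimal {V : Type*} [Finite V] (r : V → V → Prop)
    (hacyc : ¬ ∃ a : V, Relation.TransGen r a a)
    (s : V → V → Prop) (hs : Relation.TransGen s = Relation.TransGen r) :
    ∀ a b : V,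
      (r a b ∧ ¬ ∃ c : V, Relation.TransGen r a c ∧ Relation.TransGen r c b) →
      s a b := by
  rintro a b ⟨hab, hn⟩
  have h : Relation.TransGen s a b := hs ▸ Relation.TransGen.single hab
  rw [← hs] at hn
  cases h with
  | single h1 => exact h1
  | tail h1 h2 => exact absurd ⟨_, h1, Relation.TransGen.single h2⟩ hn
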